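/- arXiv:1701.07094 — 5 statements merged into one kernel-verified Lean document; each statement's English description precedes it below -/
import Mathlib

section
/- Let A > 0. The curve x̄(t) = (1, x̄₂(t)) with x̄₂(t) = (2/π)·arctan(e^{−π²At}) is an exact solution of the unperturbed (ε = 0) Double-Gyre system: for every t ∈ ℝ, x̄₁'(t) = −πA sin(π·x̄₁(t)) cos(π·x̄₂(t)) (which equals 0) and x̄₂'(t) = πA cos(π·x̄₁(t)) sin(π·x̄₂(t)) = −πA·sech(π²At). -/
open Real Filter Topology

/-- The heteroclinic parametrization: x̄₂(t) = (2/π)·arctan(e^{−π²At}). -/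
noncomputable def xbar2 (A t : ℝ) : ℝ := (2 / π) * Real.arctan (Real.exp (-(π ^ 2 * A * t)))

theorem sin_two_mul_arctan (x : ℝ) : Real.sin (2 * Real.arctan x) = 2 * x / (1 + x ^ 2) := by
  have h : 0 < 1 + x ^ 2 := by positivity
  rw [Real.sin_two_mul, Real.sin_arctan, Real.cos_arctan, mul_assoc, div_mul_div_comm,
    Real.mul_self_sqrt h.le, mul_one, mul_div_assoc]

theorem two_mul_exp_neg_div_one_add_sq (s : ℝ) :
    2 * Real.exp (-s) / (1 + Real.exp (-s) ^ 2) = (Real.cosh s)⁻¹ := by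
  rw [Real.cosh_eq, Real.exp_neg]
  have := Real.exp_pos s
  field_simp

theorem sin_pi_mul_xbar2 (A t : ℝ) :
    Real.sin (π * xbar2 A t) = (Real.cosh (π ^ 2 * A * t))⁻¹ := by
  have h : π * xbar2 A t = 2 * Real.arctan (Real.exp (-(π ^ 2 * A * t))) := by
    unfold xbar2
    field_simp
  rw [h, sin_two_mul_arctan, two_mul_exp_neg_div_one_add_sq]

theorem hasDerivAt_xbar2 (A t : ℝ) :
    HasDerivAt (xbar2 A) (-(π * A) * (Real.cosh (π ^ 2 * A * t))⁻¹) t := by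
  have h := ((((hasDerivAt_id t).const_mul (π ^ 2 * A)).neg.exp).arctan).const_mul (2 / π)
  refine h.congr_deriv ?_
  rw [← two_mul_exp_neg_div_one_add_sq]
  simp only [id, Pi.neg_apply]
  field_simp

/-- the curve (1, x̄₂(t)) is an exact solution of the unperturbed
(ε = 0) Double-Gyre system. -/
theorem stmt0 (A : ℝ) (hA : 0 < A) (t : ℝ) :
    (-(π * A) * Real.sin (π * 1) * Real.cos (π * xbar2 A t) = 0 ∧
      HasDerivAt (fun _ : ℝ => (1 : ℝ))
        (-(π * A) * Real.sin (π * 1) * Real.cos (π * xbar2 A t)) t) ∧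
    HasDerivAt (xbar2 A) (π * A * Real.cos (π * 1) * Real.sin (π * xbar2 A t)) t ∧
    π * A * Real.cos (π * 1) * Real.sin (π * xbar2 A t)
      = -(π * A) * (Real.cosh (π ^ 2 * A * t))⁻¹ := by
  have h₁ : -(π * A) * Real.sin (π * 1) * Real.cos (π * xbar2 A t) = 0 := by simp
  have h₂ : π * A * Real.cos (π * 1) * Real.sin (π * xbar2 A t)
      = -(π * A) * (Real.cosh (π ^ 2 * A * t))⁻¹ := by
    rw [sin_pi_mul_xbar2, mul_one, Real.cos_pi, mul_neg_one]
  refine ⟨⟨h₁, ?_⟩, ?_, h₂⟩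
  · rw [h₁]
    exact hasDerivAt_const t 1
  · rw [h₂]
    exact hasDerivAt_xbar2 A t
end

section
/- For every a > 0 and every ω ∈ ℝ, the function τ ↦ tanh(aτ)·sech(aτ)·sin(ωτ) is integrable on ℝ and ∫_{−∞}^{∞} tanh(aτ) sech(aτ) sin(ωτ) dτ = (πω/a²)·sech(πω/(2a)). -/
open Real Filter Topology MeasureTheory

/-- Hyperbolic secant. -/
noncomputable def sech (s : ℝ) : ℝ := (Real.cosh s)⁻¹

theorem image_sigmoid_two_mul_univ :
    (fun t : ℝ => Real.sigmoid (2 * t)) '' Set.univ = Set.Ioo 0 1 := by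
  rw [Set.image_univ, ← Real.range_sigmoid]
  exact (mul_left_surjective₀ (two_ne_zero (α := ℝ))).range_comp Real.sigmoid

theorem hasDerivAt_sigmoid_two_mul (t : ℝ) :
    HasDerivAt (fun t : ℝ => Real.sigmoid (2 * t))
      (2 * (Real.sigmoid (2 * t) * (1 - Real.sigmoid (2 * t)))) t := by
  have h := (Real.hasDerivAt_sigmoid (2 * t)).comp t ((hasDerivAt_id t).const_mul 2)
  exact h.congr_deriv (by ring)

theorem sigmoid_two_mul_eq_exp (t : ℝ) :
    Real.sigmoid (2 * t) = Real.exp (t - Real.log (2 * Real.cosh t)) := by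
  have hc := Real.cosh_pos t
  have ht := (Real.exp_pos t).ne'
  rw [Real.exp_sub, Real.exp_log (by positivity), Real.sigmoid_def, Real.cosh_eq,
    show -(2 * t) = -t + -t by ring, Real.exp_add, Real.exp_neg]
  field_simp

theorem one_sub_sigmoid_two_mul_eq_exp (t : ℝ) :
    1 - Real.sigmoid (2 * t) = Real.exp (-t - Real.log (2 * Real.cosh t)) := by
  rw [← Real.sigmoid_neg, ← mul_neg, sigmoid_two_mul_eq_exp, Real.cosh_neg]

/-- The substitution `x = sigmoid (2 * t)` turns the integrand of `Β (1/2 + iw, 1/2 - iw)` into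
`exp (2iwt) / cosh t`. -/
theorem abs_deriv_smul_beta_integrand (w t : ℝ) :
    |2 * (Real.sigmoid (2 * t) * (1 - Real.sigmoid (2 * t)))| •
      (((Real.sigmoid (2 * t) : ℝ) : ℂ) ^ ((1 / 2 + w * Complex.I : ℂ) - 1) *
        (1 - ((Real.sigmoid (2 * t) : ℝ) : ℂ)) ^ ((1 / 2 - w * Complex.I : ℂ) - 1)) =
      sech t • Complex.exp ((2 * w * t : ℝ) * Complex.I) := by
  have hsech : sech t = 2 * Real.exp (-Real.log (2 * Real.cosh t)) := by
    have hc := Real.cosh_pos t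
    rw [Real.exp_neg, Real.exp_log (by positivity), sech]
    field_simp
  have hcpow (y : ℝ) (z : ℂ) : ((Real.exp y : ℝ) : ℂ) ^ z = Complex.exp (y * z) := by
    rw [Complex.cpow_def_of_ne_zero (by exact_mod_cast (Real.exp_pos y).ne'),
      ← Complex.ofReal_log (Real.exp_pos y).le, Real.log_exp]
  rw [← Complex.ofReal_one, ← Complex.ofReal_sub, one_sub_sigmoid_two_mul_eq_exp,
    sigmoid_two_mul_eq_exp, hsech, abs_of_pos (by positivity), hcpow, hcpow]
  simp only [Complex.real_smul]
  push_cast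
  simp only [mul_assoc, ← Complex.exp_add]
  congr 2
  ring

theorem integrable_sech_smul_exp (w : ℝ) :
    Integrable (fun t : ℝ => sech t • Complex.exp ((2 * w * t : ℝ) * Complex.I)) := by
  have h := Complex.betaIntegral_convergent (u := 1 / 2 + w * Complex.I)
    (v := 1 / 2 - w * Complex.I) (by simp) (by simp)
  rw [intervalIntegrable_iff_integrableOn_Ioo_of_le zero_le_one, ← image_sigmoid_two_mul_univ,
    integrableOn_image_iff_integrableOn_abs_deriv_smul MeasurableSet.univ
      (fun t _ => (hasDerivAt_sigmoid_two_mul t).hasDerivWithinAt)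
      (Real.sigmoid_injective.comp (mul_right_injective₀ (two_ne_zero (α := ℝ)))).injOn,
    integrableOn_univ] at h
  simpa only [abs_deriv_smul_beta_integrand] using h

theorem integral_sech_smul_exp (w : ℝ) :
    ∫ t : ℝ, sech t • Complex.exp ((2 * w * t : ℝ) * Complex.I) = (π * sech (π * w) : ℝ) := by
  have h := Complex.Gamma_mul_Gamma_eq_betaIntegral (s := 1 / 2 + w * Complex.I)
    (t := 1 / 2 - w * Complex.I) (by simp) (by simp)
  rw [show (1 / 2 - w * Complex.I : ℂ) = 1 - (1 / 2 + w * Complex.I) by ring,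
    Complex.Gamma_mul_Gamma_one_sub, add_sub_cancel, Complex.Gamma_one, one_mul,
    show (1 - (1 / 2 + w * Complex.I) : ℂ) = 1 / 2 - w * Complex.I by ring,
    Complex.betaIntegral, intervalIntegral.integral_of_le zero_le_one,
    integral_Ioc_eq_integral_Ioo, ← image_sigmoid_two_mul_univ,
    integral_image_eq_integral_abs_deriv_smul MeasurableSet.univ
      (fun t _ => (hasDerivAt_sigmoid_two_mul t).hasDerivWithinAt)
      (Real.sigmoid_injective.comp (mul_right_injective₀ (two_ne_zero (α := ℝ)))).injOn,
    setIntegral_univ] at h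
  simp only [abs_deriv_smul_beta_integrand] at h
  rw [← h, show (π * (1 / 2 + w * Complex.I) : ℂ) = (π * w : ℝ) * Complex.I + π / 2 by
    push_cast; ring, Complex.sin_add_pi_div_two, Complex.cos_mul_I, sech]
  push_cast
  rw [div_eq_mul_inv]

theorem integrable_sech : Integrable sech := by
  simpa using (integrable_sech_smul_exp 0).re

theorem integral_sech_mul_cos (ω : ℝ) :
    ∫ t : ℝ, sech t * Real.cos (ω * t) = π * sech (π * ω / 2) := by
  have h := congrArg Complex.re (integral_sech_smul_exp (ω / 2))
  rw [Complex.ofReal_re, ← Complex.reCLM_apply,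
    ← Complex.reCLM.integral_comp_comm (integrable_sech_smul_exp _)] at h
  rw [mul_div_assoc, ← h]
  congr 1 with t
  rw [Complex.reCLM_apply, Complex.smul_re, Complex.exp_ofReal_mul_I_re, smul_eq_mul]
  congr 2
  ring

theorem continuous_sech : Continuous sech :=
  Real.continuous_cosh.inv₀ fun t => (Real.cosh_pos t).ne'

theorem hasDerivAt_sech (t : ℝ) : HasDerivAt sech (-(Real.tanh t * sech t)) t := by
  have hc := (Real.cosh_pos t).ne'
  refine ((Real.hasDerivAt_cosh t).inv hc).congr_deriv ?_
  rw [Real.tanh_eq_sinh_div_cosh, sech]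
  field_simp

theorem integrable_sech_mul_of_bounded {f : ℝ → ℝ} (hf : Continuous f) (h : ∀ t, |f t| ≤ 1) :
    Integrable (fun t => sech t * f t) :=
  integrable_sech.mul_bdd (c := 1) hf.aestronglyMeasurable (Eventually.of_forall h)

theorem integrable_tanh_mul_sech_mul_sin (ω : ℝ) :
    Integrable (fun t : ℝ => Real.tanh t * sech t * Real.sin (ω * t)) := by
  have htanh : Continuous Real.tanh := by
    simp only [funext Real.tanh_eq_sinh_div_cosh]
    exact Real.continuous_sinh.div Real.continuous_cosh fun t => (Real.cosh_pos t).ne'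
  refine (integrable_sech_mul_of_bounded (f := fun t => Real.tanh t * Real.sin (ω * t))
    (by fun_prop) fun t => ?_).congr (Eventually.of_forall fun t => by ring)
  rw [abs_mul]
  exact mul_le_one₀ (Real.abs_tanh_lt_one t).le (abs_nonneg _) (Real.abs_sin_le_one _)

theorem integral_tanh_mul_sech_mul_sin (ω : ℝ) :
    ∫ t : ℝ, Real.tanh t * sech t * Real.sin (ω * t) = π * ω * sech (π * ω / 2) := by
  have hsin (t : ℝ) : HasDerivAt (fun t => Real.sin (ω * t)) (ω * Real.cos (ω * t)) t :=
    (((hasDerivAt_id t).const_mul ω).sin).congr_deriv (by simp [mul_comm])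
  have hcos : Integrable (fun t => sech t * (ω * Real.cos (ω * t))) :=
    ((integrable_sech_mul_of_bounded (f := fun t => Real.cos (ω * t)) (by fun_prop)
      fun t => Real.abs_cos_le_one _).const_mul ω).congr (Eventually.of_forall fun t => by ring)
  have h := integral_mul_deriv_eq_deriv_mul_of_integrable
    (fun t _ => hasDerivAt_sech t) (fun t _ => hsin t) hcos
    ((integrable_tanh_mul_sech_mul_sin ω).neg.congr (Eventually.of_forall fun t => by
      simp))
    (integrable_sech_mul_of_bounded (f := fun t => Real.sin (ω * t)) (by fun_prop)
      fun t => Real.abs_sin_le_one _)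
  simp only [neg_mul, integral_neg, neg_neg, mul_left_comm _ ω, integral_const_mul,
    integral_sech_mul_cos] at h
  rw [← h]
  ring

/-- τ ↦ tanh(aτ)·sech(aτ)·sin(ωτ) is integrable on ℝ with
∫ = (πω/a²)·sech(πω/(2a)). -/
theorem stmt6 (a : ℝ) (ha : 0 < a) (ω : ℝ) :
    Integrable (fun τ : ℝ => Real.tanh (a * τ) * sech (a * τ) * Real.sin (ω * τ)) ∧
    ∫ τ : ℝ, Real.tanh (a * τ) * sech (a * τ) * Real.sin (ω * τ)
      = (π * ω / a ^ 2) * sech (π * ω / (2 * a)) := by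
  have hscale (τ : ℝ) : ω * τ = ω / a * (a * τ) := by field_simp
  simp only [hscale]
  refine ⟨(integrable_tanh_mul_sech_mul_sin (ω / a)).comp_mul_left' ha.ne', ?_⟩
  rw [Measure.integral_comp_mul_left (fun t => Real.tanh t * sech t * Real.sin (ω / a * t)),
    integral_tanh_mul_sech_mul_sin, abs_of_pos (inv_pos.mpr ha), smul_eq_mul,
    show π * (ω / a) / 2 = π * ω / (2 * a) by field_simp]
  field_simp
end

section
/- Let A > 0 and ω > 0. Along the unperturbed heteroclinic x̄(τ) = (1, x̄₂(τ)), the wedge product of the unperturbed field f and the perturbation field g satisfies, for all τ, s ∈ ℝ: f(x̄(τ)) ∧ g(x̄(τ), s) = −π³A²·tanh(π²Aτ)·sech(π²Aτ)·sin(ωs), where (u₁,u₂) ∧ (v₁,v₂) := u₁v₂ − u₂v₁. -/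
open Real Filter Topology

/-- First component of the unperturbed (ε = 0) Double-Gyre vector field. -/
noncomputable def f1 (A x1 x2 : ℝ) : ℝ := -(π * A) * Real.sin (π * x1) * Real.cos (π * x2)

/-- Second component of the unperturbed (ε = 0) Double-Gyre vector field. -/
noncomputable def f2 (A x1 x2 : ℝ) : ℝ := π * A * Real.cos (π * x1) * Real.sin (π * x2)

/-- First component of the first-order perturbation field g. -/
noncomputable def g1 (A ω x1 x2 t : ℝ) : ℝ :=
  Real.sin (ω * t) * (-(π ^ 2 * A) * (x1 ^ 2 - 2 * x1) * Real.cos (π * x2) * Real.cos (π * x1))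

/-- Second component of the first-order perturbation field g. -/
noncomputable def g2 (A ω x1 x2 t : ℝ) : ℝ :=
  Real.sin (ω * t) * (π * A * Real.sin (π * x2) *
    (2 * Real.cos (π * x1) * (x1 - 1) - π * (x1 ^ 2 - 2 * x1) * Real.sin (π * x1)))

/-- The double-angle form of the Gudermannian relation for the sine. -/
theorem sin_two_mul_arctan_exp_neg (θ : ℝ) :
    Real.sin (2 * Real.arctan (Real.exp (-θ))) = sech θ := by
  rw [Real.sin_two_mul, ← Real.tan_mul_cos (Real.cos_arctan_pos _).ne', Real.tan_arctan, mul_assoc,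
    mul_assoc, ← sq, Real.cos_sq_arctan, sech, Real.cosh_eq, Real.exp_neg]
  field_simp

/-- The double-angle form of the Gudermannian relation for the cosine. -/
theorem cos_two_mul_arctan_exp_neg (θ : ℝ) :
    Real.cos (2 * Real.arctan (Real.exp (-θ))) = Real.tanh θ := by
  rw [Real.cos_two_mul, Real.cos_sq_arctan, Real.tanh_eq_sinh_div_cosh, Real.sinh_eq, Real.cosh_eq,
    Real.exp_neg]
  field_simp
  ring

theorem pi_mul_xbar2 (A t : ℝ) :
    π * xbar2 A t = 2 * Real.arctan (Real.exp (-(π ^ 2 * A * t))) := by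
  rw [xbar2]
  field_simp

/-- along the unperturbed heteroclinic x̄(τ) = (1, x̄₂(τ)),
f(x̄(τ)) ∧ g(x̄(τ), s) = −π³A²·tanh(π²Aτ)·sech(π²Aτ)·sin(ωs). -/
theorem stmt9 (A ω : ℝ) (hA : 0 < A) (hω : 0 < ω) (τ s : ℝ) :
    f1 A 1 (xbar2 A τ) * g2 A ω 1 (xbar2 A τ) s
      - f2 A 1 (xbar2 A τ) * g1 A ω 1 (xbar2 A τ) s
      = -(π ^ 3 * A ^ 2) * Real.tanh (π ^ 2 * A * τ) * sech (π ^ 2 * A * τ) * Real.sin (ω * s) := by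
  simp only [f1, f2, g1, g2, pi_mul_xbar2, sin_two_mul_arctan_exp_neg, cos_two_mul_arctan_exp_neg,
    mul_one, Real.sin_pi, Real.cos_pi]
  ring
end

section
/- Let A > 0, ω > 0, 0 < |ε| < 1/2, and let t ∈ ℝ satisfy s := sin(ωt) ≠ 0, and set x̃ := (2εs − 1 + √(1 + 4ε²s²)) / (2εs). Then for every x₁ with x̃ < x₁ < 2 one has 1 < φ(x₁, t) < 2, and consequently the first component of the Double-Gyre velocity field on the bottom boundary is positive there: −πA sin(πφ(x₁, t)) > 0. -/
open Real Filter Topology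

/-- The phase function φ(x₁,t) of the Double-Gyre with parameters ε, ω. -/
noncomputable def phi (ε ω x1 t : ℝ) : ℝ :=
  ε * Real.sin (ω * t) * x1 ^ 2 + (1 - 2 * ε * Real.sin (ω * t)) * x1

/-- For `0 < |a| < 1/2`, the quadratic `a x² + (1 - 2a) x` takes values in `(1, 2)` between
its preimage `(2a - 1 + √(1 + 4a²)) / (2a)` of `1` and its preimage `2` of `2`. -/
lemma quadratic_mem_Ioo {a x : ℝ} (ha : a ≠ 0) (ha2 : |a| < 1 / 2)
    (hx : (2 * a - 1 + √(1 + 4 * a ^ 2)) / (2 * a) < x) (hx2 : x < 2) :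
    1 < a * x ^ 2 + (1 - 2 * a) * x ∧ a * x ^ 2 + (1 - 2 * a) * x < 2 := by
  obtain ⟨hl, hu⟩ := abs_lt.mp ha2
  set r := √(1 + 4 * a ^ 2)
  have hr0 : 0 ≤ r := Real.sqrt_nonneg _
  have hr : r ^ 2 = 1 + 4 * a ^ 2 := Real.sq_sqrt (by positivity)
  set y := (2 * a - 1 + r) / (2 * a) with hy
  have hay : 2 * a * y = 2 * a - 1 + r := by
    rw [hy]
    field_simp
  have hd : 0 < r + 1 - 2 * a := by linarith
  have hyd : y * (r + 1 - 2 * a) = 2 :=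
    mul_left_cancel₀ (mul_ne_zero two_ne_zero ha) (by
      linear_combination (r + 1 - 2 * a) * hay + hr)
  have hy0 : 0 < y := pos_of_mul_pos_left (by rw [hyd]; norm_num) hd.le
  have hx0 : 0 < x := hy0.trans hx
  constructor
  · have hfac : 0 < a * x + (r + 1 - 2 * a) / 2 := by nlinarith
    have hprod := mul_pos (sub_pos.mpr hx) hfac
    linarith [show (x - y) * (a * x + (r + 1 - 2 * a) / 2)
      = a * x ^ 2 + (1 - 2 * a) * x - 1 by linear_combination -(x / 2) * hay - hyd / 2]
  · have hfac : 0 < 1 + a * x := by nlinarith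
    have hprod := mul_pos (sub_pos.mpr hx2) hfac
    linarith [show (2 - x) * (1 + a * x) = 2 - (a * x ^ 2 + (1 - 2 * a) * x) by ring]

/-- for 0 < |ε| < 1/2 and s = sin(ωt) ≠ 0, with
x̃ = (2εs − 1 + √(1 + 4ε²s²))/(2εs), every x₁ ∈ (x̃, 2) satisfies 1 < φ(x₁,t) < 2, and
the first component of the Double-Gyre field on the bottom boundary is positive there. -/
theorem stmt17 (A ε ω : ℝ) (hA : 0 < A) (hε : 0 < |ε|) (hε2 : |ε| < 1 / 2) (hω : 0 < ω)
    (t : ℝ) (hs : Real.sin (ω * t) ≠ 0) :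
    ∀ x1 : ℝ,
      (2 * ε * Real.sin (ω * t) - 1
          + Real.sqrt (1 + 4 * ε ^ 2 * Real.sin (ω * t) ^ 2)) / (2 * ε * Real.sin (ω * t)) < x1 →
      x1 < 2 →
      1 < phi ε ω x1 t ∧ phi ε ω x1 t < 2 ∧ 0 < -(π * A) * Real.sin (π * phi ε ω x1 t) := by
  intro x1 hx hx2
  have ha : ε * Real.sin (ω * t) ≠ 0 := mul_ne_zero (abs_pos.mp hε) hs
  have ha2 : |ε * Real.sin (ω * t)| < 1 / 2 := by
    rw [abs_mul]
    exact (mul_le_of_le_one_right hε.le (Real.abs_sin_le_one _)).trans_lt hε2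
  have hφ : 1 < phi ε ω x1 t ∧ phi ε ω x1 t < 2 := by
    have h := quadratic_mem_Ioo (x := x1) ha ha2 (by
      simpa only [mul_pow, mul_assoc] using hx) hx2
    simpa only [phi, mul_assoc] using h
  refine ⟨hφ.1, hφ.2, mul_pos_of_neg_of_neg (neg_neg_of_pos (mul_pos pi_pos hA)) ?_⟩
  have hsin : 0 < Real.sin (π * phi ε ω x1 t - π) :=
    Real.sin_pos_of_pos_of_lt_pi (by nlinarith [pi_pos, hφ.1]) (by nlinarith [pi_pos, hφ.2])
  rw [Real.sin_sub_pi] at hsin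
  linarith
end

section
/- Let A > 0 and let z : ℝ → ℝ be differentiable with z'(t) = −πA·sin(π·z(t)) for all t, and z(0) ∈ (0, 1). Then z(t) ∈ (0, 1) for all t ≥ 0, z is strictly decreasing on [0, ∞), and z(t) → 0 as t → ∞. (This is the relative coordinate z = x₁ − 1 of a trajectory on the invariant top boundary x₂ = 1 of the unperturbed Double-Gyre, showing attraction toward the hyperbolic point.) -/
open Real Filter Topology

/-- The double-angle formula for sine in terms of the tangent of the half angle. -/
lemma sin_two_mul_arctan_eq (w : ℝ) : Real.sin (2 * Real.arctan w) = 2 * w / (1 + w ^ 2) := by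
  have h : (0 : ℝ) < 1 + w ^ 2 := by positivity
  have hs : √(1 + w ^ 2) * √(1 + w ^ 2) = 1 + w ^ 2 := Real.mul_self_sqrt h.le
  rw [Real.sin_two_mul, Real.sin_arctan, Real.cos_arctan, mul_assoc, div_mul_div_comm, hs]
  ring

/-- The function `t ↦ (2 / π) * arctan (C * exp (-π² A t))` solves `z' = -π A sin (π z)`. -/
lemma hasDerivAt_arctan_exp_solution (A C t : ℝ) :
    HasDerivAt (fun s : ℝ => 2 / π * Real.arctan (C * Real.exp (-(π ^ 2 * A) * s)))
      (-(π * A) * Real.sin (π * (2 / π * Real.arctan (C * Real.exp (-(π ^ 2 * A) * t))))) t := by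
  have hpi : π ≠ 0 := Real.pi_ne_zero
  have h := ((((hasDerivAt_id t).const_mul (-(π ^ 2 * A))).exp.const_mul C).arctan).const_mul
    (2 / π)
  simp only [id, mul_one] at h
  refine h.congr_deriv ?_
  have e : π * (2 / π * Real.arctan (C * Real.exp (-(π ^ 2 * A) * t))) =
      2 * Real.arctan (C * Real.exp (-(π ^ 2 * A) * t)) := by
    field_simp
  rw [e, sin_two_mul_arctan_eq]
  have hw : 1 + (C * Real.exp (-(π ^ 2 * A) * t)) ^ 2 ≠ 0 := by positivity
  field_simp

/-- The vector field `x ↦ -π A sin (π x)` is Lipschitz. -/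
lemma exists_lipschitzWith_sin_field (A : ℝ) :
    ∃ K, LipschitzWith K (fun x : ℝ => -(π * A) * Real.sin (π * x)) := by
  have hd (x : ℝ) : HasDerivAt (fun x : ℝ => -(π * A) * Real.sin (π * x))
      (-(π * A) * (Real.cos (π * x) * π)) x := by
    simpa using (((hasDerivAt_id x).const_mul π).sin).const_mul (-(π * A))
  refine ⟨‖π * A‖₊ * ‖π‖₊, lipschitzWith_of_nnnorm_deriv_le
    (fun x => (hd x).differentiableAt) fun x => ?_⟩
  rw [(hd x).deriv, ← NNReal.coe_le_coe]
  simp only [coe_nnnorm, NNReal.coe_mul, norm_mul, norm_neg]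
  have hc : ‖Real.cos (π * x)‖ ≤ 1 := Real.abs_cos_le_one _
  gcongr
  exact mul_le_of_le_one_left (norm_nonneg _) hc

/-- for the scalar ODE z' = −πA sin(πz) (the unperturbed Double-Gyre
restricted to the invariant line x₂ = 1, in the coordinate z = x₁ − 1), any solution with
z(0) ∈ (0,1) stays in (0,1) for t ≥ 0, is strictly decreasing on [0,∞), and tends to 0. -/
theorem stmt18 (A : ℝ) (hA : 0 < A) (z : ℝ → ℝ)
    (hz : ∀ t : ℝ, HasDerivAt z (-(π * A) * Real.sin (π * z t)) t)
    (h0 : z 0 ∈ Set.Ioo (0 : ℝ) 1) :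
    (∀ t ≥ (0 : ℝ), z t ∈ Set.Ioo (0 : ℝ) 1) ∧
    StrictAntiOn z (Set.Ici (0 : ℝ)) ∧
    Tendsto z atTop (nhds 0) := by
  have hpi := Real.pi_pos
  obtain ⟨h0, h1⟩ := h0
  obtain ⟨K, hK⟩ := exists_lipschitzWith_sin_field A
  have hlt : π / 2 * z 0 < π / 2 := mul_lt_of_lt_one_right (by positivity) h1
  obtain ⟨C, hC, hCz⟩ : ∃ C, 0 < C ∧ Real.arctan C = π / 2 * z 0 :=
    ⟨Real.tan (π / 2 * z 0), Real.tan_pos_of_pos_of_lt_pi_div_two (by positivity) hlt,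
      Real.arctan_tan (by linarith [mul_pos (half_pos hpi) h0]) hlt⟩
  have hrate : 0 < π ^ 2 * A := by positivity
  obtain rfl : z = fun s : ℝ => 2 / π * Real.arctan (C * Real.exp (-(π ^ 2 * A) * s)) := by
    refine ODE_solution_unique_univ (v := fun _ x => -(π * A) * Real.sin (π * x))
      (s := fun _ => Set.univ) (t₀ := 0) (fun _ => hK.lipschitzOnWith)
      (fun t => ⟨hz t, trivial⟩) (fun t => ⟨hasDerivAt_arctan_exp_solution A C t, trivial⟩) ?_
    simp only [mul_zero, Real.exp_zero, mul_one, hCz]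
    field_simp
  refine ⟨fun t _ => ⟨?_, ?_⟩, fun s _ t _ hst => ?_, ?_⟩
  · have : 0 < Real.arctan (C * Real.exp (-(π ^ 2 * A) * t)) :=
      Real.arctan_pos.2 (by positivity)
    positivity
  · calc 2 / π * Real.arctan (C * Real.exp (-(π ^ 2 * A) * t)) < 2 / π * (π / 2) := by
          gcongr
          exact Real.arctan_lt_pi_div_two _
      _ = 1 := by field_simp
  · refine mul_lt_mul_of_pos_left (Real.arctan_strictMono ?_) (by positivity)
    refine mul_lt_mul_of_pos_left (Real.exp_lt_exp.2 ?_) hC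
    exact mul_lt_mul_of_neg_left hst (neg_lt_zero.2 hrate)
  · have he : Tendsto (fun s : ℝ => C * Real.exp (-(π ^ 2 * A) * s)) atTop (𝓝 (C * 0)) :=
      (Real.tendsto_exp_atBot.comp
        (tendsto_id.const_mul_atTop_of_neg (neg_lt_zero.2 hrate))).const_mul C
    simpa using ((Real.continuous_arctan.tendsto _).comp he).const_mul (2 / π)
end
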